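/- arXiv:1909.11465 — 2 statements merged into one kernel-verified Lean document; each statement's English description precedes it below -/
import Mathlib

section
/- Let n be even, n ≥ 2, and let F : 𝔽₂ⁿ → 𝔽₂ⁿ be an APN function. Then there exists a nonzero λ ∈ 𝔽₂ⁿ such that the linear space of the component F_λ is trivial: V(F_λ) = {0}. -/
/-- The component `F_λ` of a vectorial Boolean function: `x ↦ λ · F(x)` (dot product mod 2). -/
def comp {n : ℕ} (lam : Fin n → ZMod 2) (F : (Fin n → ZMod 2) → (Fin n → ZMod 2)) :
    (Fin n → ZMod 2) → ZMod 2 :=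
  fun x => ∑ i, lam i * F x i

/-- `F` is APN: for every nonzero `a` and every `b`, `F(x+a) + F(x) = b` has at most
2 solutions. -/
def IsAPN {n : ℕ} (F : (Fin n → ZMod 2) → (Fin n → ZMod 2)) : Prop :=
  ∀ a : Fin n → ZMod 2, a ≠ 0 → ∀ b : Fin n → ZMod 2,
    (Finset.univ.filter fun x => F (x + a) + F x = b).card ≤ 2

/-- The nontrivial additive character of `𝔽₂` with integer values. -/
def signChar (t : ZMod 2) : ℤ := if t = 0 then 1 else -1

theorem signChar_add (s t : ZMod 2) : signChar (s + t) = signChar s * signChar t := by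
  revert s t; decide

theorem signChar_sq (t : ZMod 2) : signChar t ^ 2 = 1 := by
  revert t; decide

theorem signChar_sum {ι : Type*} (s : Finset ι) (f : ι → ZMod 2) :
    signChar (∑ i ∈ s, f i) = ∏ i ∈ s, signChar (f i) := by
  classical
  induction s using Finset.induction_on with
  | empty => simp [signChar]
  | insert a s ha ih => rw [Finset.sum_insert ha, Finset.prod_insert ha, signChar_add, ih]

theorem sum_signChar_mul (z : ZMod 2) :
    ∑ t : ZMod 2, signChar (t * z) = if z = 0 then 2 else 0 := by
  revert z; decide

theorem sum_signChar_dotProduct {n : ℕ} (z : Fin n → ZMod 2) :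
    ∑ l : Fin n → ZMod 2, signChar (∑ i, l i * z i) = if z = 0 then 2 ^ n else 0 := by
  simp_rw [signChar_sum]
  rw [← Fintype.prod_sum (fun i t => signChar (t * z i))]
  simp_rw [sum_signChar_mul]
  split_ifs with h
  · simp [h]
  · obtain ⟨i, hi⟩ := Function.ne_iff.mp h
    exact Finset.prod_eq_zero (Finset.mem_univ i) (if_neg hi)

theorem pi_zmod_two_add_self {n : ℕ} (x : Fin n → ZMod 2) : x + x = 0 :=
  funext fun i => CharTwo.add_self_eq_zero (x i)

theorem pi_zmod_two_add_eq_zero {n : ℕ} (x y : Fin n → ZMod 2) : x + y = 0 ↔ x = y := by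
  constructor
  · intro h
    funext i
    exact CharTwo.add_eq_zero.mp (congrFun h i)
  · rintro rfl
    exact pi_zmod_two_add_self x

/-- The square of a character sum is the sum of the autocorrelations. -/
theorem sq_sum_signChar {n : ℕ} (g : (Fin n → ZMod 2) → ZMod 2) :
    (∑ x, signChar (g x)) ^ 2 = ∑ b, ∑ x, signChar (g (x + b) + g x) := by
  rw [sq, Finset.sum_mul_sum]
  simp_rw [signChar_add]
  conv_rhs => rw [Finset.sum_comm]
  refine Finset.sum_congr rfl fun x _ => ?_
  rw [← Equiv.sum_comp (Equiv.addLeft x)]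
  exact Finset.sum_congr rfl fun b _ => mul_comm _ _

/-- The autocorrelation at `a` of the component `F_λ`. -/
def componentAutocorrelation {n : ℕ} (F : (Fin n → ZMod 2) → (Fin n → ZMod 2))
    (a lam : Fin n → ZMod 2) : ℤ :=
  ∑ x, signChar (comp lam F (x + a) + comp lam F x)

theorem sum_sq_componentAutocorrelation_le {n : ℕ}
    {F : (Fin n → ZMod 2) → (Fin n → ZMod 2)} (hF : IsAPN F)
    {a : Fin n → ZMod 2} (ha : a ≠ 0) :
    ∑ lam, componentAutocorrelation F a lam ^ 2 ≤ 2 * (2 ^ n) ^ 2 := by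
  have key : ∑ lam, componentAutocorrelation F a lam ^ 2 =
      ∑ x, ∑ y, if F (y + a) + F y = F (x + a) + F x then (2 : ℤ) ^ n else 0 := by
    simp_rw [componentAutocorrelation, sq, Finset.sum_mul_sum]
    rw [Finset.sum_comm]
    refine Finset.sum_congr rfl fun x _ => ?_
    rw [Finset.sum_comm]
    refine Finset.sum_congr rfl fun y _ => ?_
    simp_rw [← pi_zmod_two_add_eq_zero (F (y + a) + F y)]
    rw [← sum_signChar_dotProduct]
    refine Finset.sum_congr rfl fun lam _ => ?_
    rw [← signChar_add]
    congr 1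
    simp only [comp, Pi.add_apply, mul_add, Finset.sum_add_distrib]
    ring
  rw [key]
  calc _ ≤ ∑ _x : Fin n → ZMod 2, 2 * (2 : ℤ) ^ n := by
        refine Finset.sum_le_sum fun x _ => ?_
        rw [← Finset.sum_filter, Finset.sum_const, nsmul_eq_mul]
        gcongr
        exact_mod_cast hF a ha (F (x + a) + F x)
    _ = 2 * (2 ^ n) ^ 2 := by
        simp [ZMod.card]
        ring

theorem componentAutocorrelation_sq_of_const {n : ℕ}
    {F : (Fin n → ZMod 2) → (Fin n → ZMod 2)} {a lam : Fin n → ZMod 2} {c : ZMod 2}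
    (h : ∀ x, comp lam F (x + a) + comp lam F x = c) :
    componentAutocorrelation F a lam ^ 2 = (2 ^ n) ^ 2 := by
  simp [componentAutocorrelation, h, mul_pow, signChar_sq, ZMod.card]

/-- In a nonzero direction, if one nonzero component of an APN function has constant derivative,
then all other nonzero components have balanced derivative. -/
theorem componentAutocorrelation_eq_zero {n : ℕ}
    {F : (Fin n → ZMod 2) → (Fin n → ZMod 2)} (hF : IsAPN F)
    {a lam mu : Fin n → ZMod 2} (ha : a ≠ 0) (hlam : lam ≠ 0) {c : ZMod 2}
    (h : ∀ x, comp lam F (x + a) + comp lam F x = c) (hmu : mu ≠ 0) (hne : mu ≠ lam) :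
    componentAutocorrelation F a mu = 0 := by
  have h0 : componentAutocorrelation F a 0 ^ 2 = (2 ^ n) ^ 2 :=
    componentAutocorrelation_sq_of_const (c := 0) fun x => by simp [comp]
  have h1 := componentAutocorrelation_sq_of_const h
  have hsub := Finset.sum_le_sum_of_subset_of_nonneg
    (Finset.subset_univ ({0, lam, mu} : Finset (Fin n → ZMod 2)))
    (f := fun l => componentAutocorrelation F a l ^ 2) (fun _ _ _ => sq_nonneg _)
  rw [Finset.sum_insert (by simp [hlam.symm, hmu.symm]), Finset.sum_insert (by simp [hne.symm]),
    Finset.sum_singleton] at hsub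
  have hle := sum_sq_componentAutocorrelation_le hF ha
  have : componentAutocorrelation F a mu ^ 2 ≤ 0 := by linarith
  exact pow_eq_zero_iff two_ne_zero |>.mp (le_antisymm this (sq_nonneg _))

theorem sq_ne_two_mul_four_pow (m : ℕ) (k : ℤ) : k ^ 2 ≠ 2 * 4 ^ m := by
  induction m generalizing k with
  | zero =>
    intro h
    have h1 : k < 2 := by nlinarith
    have h2 : -2 < k := by nlinarith
    interval_cases k <;> simp at h
  | succ m ih =>
    intro h
    have hk : Even k := by
      rw [← Int.even_pow' two_ne_zero, h]
      exact even_two_mul _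
    obtain ⟨j, rfl⟩ := hk
    exact ih j (by rw [pow_succ 4] at h; linarith)

theorem stmt_12 (n : ℕ) (hne : Even n) (hn : 2 ≤ n)
    (F : (Fin n → ZMod 2) → (Fin n → ZMod 2)) (hF : IsAPN F) :
    ∃ lam : Fin n → ZMod 2, lam ≠ 0 ∧
      {a : Fin n → ZMod 2 | ∃ c : ZMod 2, ∀ x, comp lam F (x + a) + comp lam F x = c}
        = {0} := by
  by_contra! hcon
  have hex : ∀ l : {l : Fin n → ZMod 2 // l ≠ 0}, ∃ a : {a : Fin n → ZMod 2 // a ≠ 0},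
      ∃ c : ZMod 2, ∀ x, comp l.1 F (x + a.1) + comp l.1 F x = c := by
    intro l
    by_contra! hno
    refine hcon l.1 l.2 (Set.eq_singleton_iff_unique_mem.mpr ⟨⟨0, fun x => ?_⟩, ?_⟩)
    · rw [add_zero, CharTwo.add_self_eq_zero]
    · rintro a ⟨c, hc⟩
      by_contra ha
      obtain ⟨x, hx⟩ := hno ⟨a, ha⟩ c
      exact hx (hc x)
  choose dir val hdir using hex
  have hpos : (0 : ℤ) < (2 ^ n) ^ 2 := by positivity
  have hinj : Function.Injective dir := by
    intro l m hlm
    by_contra hlm'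
    have h0 := componentAutocorrelation_eq_zero hF (dir l).2 l.2 (hdir l) m.2
      (fun h => hlm' (Subtype.ext h.symm))
    have h1 := componentAutocorrelation_sq_of_const (hdir m)
    rw [← hlm, h0] at h1
    linarith
  have hsurj := Finite.surjective_of_injective hinj
  let l : {l : Fin n → ZMod 2 // l ≠ 0} :=
    ⟨fun _ => 1, fun h => one_ne_zero (congrFun h ⟨0, by omega⟩)⟩
  have hbal : ∀ b, b ≠ 0 → b ≠ (dir l).1 → componentAutocorrelation F b l.1 = 0 := by
    intro b hb hbl
    obtain ⟨m, hm⟩ := hsurj ⟨b, hb⟩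
    have hmb : (dir m).1 = b := congrArg Subtype.val hm
    rw [← hmb]
    refine componentAutocorrelation_eq_zero hF (dir m).2 m.2 (hdir m) l.2 fun h => hbl ?_
    rw [← hmb, Subtype.ext h]
  obtain ⟨i, hi⟩ := Function.ne_iff.mp (dir l).2
  have hi1 : (dir l).1 i = 1 := Fin.eq_one_of_ne_zero _ hi
  -- Twisting `F_λ` by a linear form makes its derivative in direction `dir l` vanish.
  have hsq := sq_sum_signChar fun x => comp l.1 F x + val l * x i
  have hterm : ∀ b, ∑ x, signChar ((comp l.1 F (x + b) + val l * (x + b) i)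
      + (comp l.1 F x + val l * x i)) =
      signChar (val l * b i) * componentAutocorrelation F b l.1 := by
    intro b
    rw [componentAutocorrelation, Finset.mul_sum]
    refine Finset.sum_congr rfl fun x _ => ?_
    rw [← signChar_add]
    congr 1
    rw [Pi.add_apply]
    linear_combination (val l * x i) * CharTwo.two_eq_zero (R := ZMod 2)
  have hcorr : ∀ b c, (∀ x, comp l.1 F (x + b) + comp l.1 F x = c) →
      componentAutocorrelation F b l.1 = signChar c * 2 ^ n := by
    intro b c h
    simp [componentAutocorrelation, h, ZMod.card, mul_comm]
  simp only [hterm] at hsq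
  rw [← Finset.sum_subset (Finset.subset_univ ({0, (dir l).1} : Finset (Fin n → ZMod 2)))
      (f := fun b => signChar (val l * b i) * componentAutocorrelation F b l.1), Finset.sum_pair (dir l).2.symm,
    hcorr 0 0 (fun x => by rw [add_zero, CharTwo.add_self_eq_zero]), hcorr _ _ (hdir l),
    hi1, ← mul_assoc, ← mul_assoc, ← signChar_add, ← signChar_add, mul_one,
    CharTwo.add_self_eq_zero] at hsq
  · obtain ⟨m, rfl⟩ := hne
    refine sq_ne_two_mul_four_pow m _ (hsq.trans ?_)
    have h4 : (4 : ℤ) ^ m = 2 ^ (m + m) := by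
      rw [← two_mul, pow_mul]
      norm_num
    simp [signChar, h4]
    ring
  · intro b _ hb
    simp only [Finset.mem_insert, Finset.mem_singleton, not_or] at hb
    rw [hbal b hb.1 hb.2, mul_zero]
end

section
/- Let n be even, n ≥ 4, and let Q : 𝔽₂ⁿ → 𝔽₂ⁿ be a pure quadratic APN function. Let B be the number of nonzero λ ∈ 𝔽₂ⁿ for which the component Q_λ is bent. Then B = 2(2ⁿ−1)/3 + 4t for some integer t ≥ 0, and 2(2ⁿ−1)/3 ≤ B ≤ 2ⁿ − 2^(n/2) − 2. -/
/-- The Hamming weight of a Boolean function: the number of inputs mapped to 1. -/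
def wt {α : Type*} [Fintype α] (f : α → ZMod 2) : ℕ :=
  (Finset.univ.filter fun x => f x = 1).card

/-- The derivative of a Boolean function at `a`. -/
def Dop {α : Type*} [Add α] (a : α) (f : α → ZMod 2) : α → ZMod 2 :=
  fun x => f (x + a) + f x

/-- `degLE d f` means the algebraic degree of `f` is at most `d`:
all `(d+1)`-fold iterated derivatives vanish. -/
def degLE {α : Type*} [Add α] (d : ℕ) (f : α → ZMod 2) : Prop :=
  ∀ l : List α, l.length = d + 1 → l.foldr Dop f = fun _ => 0

/-- A Boolean function on `n` variables is bent if all its nontrivial derivatives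
are balanced. -/
def IsBent {n : ℕ} (f : (Fin n → ZMod 2) → ZMod 2) : Prop :=
  ∀ a : Fin n → ZMod 2, a ≠ 0 → wt (Dop a f) = 2 ^ (n - 1)

open Module in
/-- The rank of an alternating bilinear form is even. -/
theorem LinearMap.BilinForm.IsAlt.even_finrank_add_finrank_ker {K V : Type*} [Field K]
    [AddCommGroup V] [Module K V] [FiniteDimensional K V] {B : LinearMap.BilinForm K V}
    (hB : B.IsAlt) : Even (finrank K V + finrank K (LinearMap.ker B)) := by
  obtain ⟨L, hL, hmax⟩ := WellFounded.has_min (wellFounded_gt (α := Submodule K V))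
    {L | L ≤ B.orthogonal L} ⟨⊥, bot_le (a := B.orthogonal ⊥)⟩
  have horth : B.orthogonal L = L := by
    refine le_antisymm (fun x hx => ?_) hL
    by_contra hxL
    refine hmax (L ⊔ K ∙ x) ?_ (lt_of_le_of_ne le_sup_left fun h => hxL ?_)
    · intro y hy
      rw [LinearMap.BilinForm.mem_orthogonal_iff] at hx ⊢
      intro z hz
      obtain ⟨u, hu, v, hv, rfl⟩ := Submodule.mem_sup.1 hy
      obtain ⟨u', hu', v', hv', rfl⟩ := Submodule.mem_sup.1 hz
      obtain ⟨c, rfl⟩ := Submodule.mem_span_singleton.1 hv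
      obtain ⟨c', rfl⟩ := Submodule.mem_span_singleton.1 hv'
      have h1 : B u' u = 0 := hL hu u' hu'
      simp [h1, hx u' hu', hB.isRefl _ _ (hx u hu), hB.self_eq_zero]
    · rw [h]
      exact Submodule.mem_sup_right (Submodule.mem_span_singleton_self x)
  have hker : L ⊓ LinearMap.ker B = LinearMap.ker B := by
    refine inf_eq_right.2 fun x hx => ?_
    rw [← horth, LinearMap.BilinForm.mem_orthogonal_iff]
    intro y _
    exact hB.isRefl _ _ (by rw [LinearMap.mem_ker.1 hx, LinearMap.zero_apply])
  have h := LinearMap.BilinForm.finrank_add_finrank_orthogonal' (B := B) L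
  rw [horth, hker] at h
  exact ⟨_, h.symm⟩

/-- A nontrivial power of four is congruent to `4` modulo `12`. -/
theorem exists_two_pow_eq_of_even {k : ℕ} (hk : Even k) (h0 : k ≠ 0) :
    ∃ u, 2 ^ k = 12 * u + 4 := by
  obtain ⟨j, rfl⟩ := hk
  obtain ⟨j, rfl⟩ := Nat.exists_eq_succ_of_ne_zero (show j ≠ 0 by omega)
  induction j with
  | zero => exact ⟨0, rfl⟩
  | succ j ih =>
    obtain ⟨u, hu⟩ := ih (by omega)
    refine ⟨4 * u + 1, ?_⟩
    rw [show (j + 1).succ + (j + 1).succ = j.succ + j.succ + 2 by omega, pow_add, hu]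
    ring

section Partition

variable {ι V : Type*} [Fintype ι] [AddCommGroup V] [Module (ZMod 2) V] [Finite V]
  {R : ι → Submodule (ZMod 2) V}

open Classical in
/-- The nonzero vectors are counted by the members of a vector space partition. -/
theorem sum_card_sub_one_of_existsUnique_mem (hR : ∀ a : V, a ≠ 0 → ∃! i, a ∈ R i) :
    ∑ i with R i ≠ ⊥, (Nat.card (R i) - 1) = Nat.card V - 1 := by
  have := Fintype.ofFinite V
  have hcard (i : ι) : Nat.card (R i) - 1 = ({a | a ≠ 0 ∧ a ∈ R i} : Finset V).card := by
    have : ({a | a ≠ 0 ∧ a ∈ R i} : Finset V) = ({a | a ∈ R i} : Finset V).erase 0 := by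
      ext a; simp
    rw [this, Finset.card_erase_of_mem (by simp), Nat.card_eq_fintype_card,
      Fintype.card_subtype]
  have hbot (i : ι) (_ : i ∈ Finset.univ) (hi : Nat.card (R i) - 1 ≠ 0) : R i ≠ ⊥ :=
    fun h => hi (by simp [h])
  rw [Finset.sum_filter_of_ne hbot]
  simp_rw [hcard, Finset.card_filter, ite_and]
  rw [Finset.sum_comm, Nat.card_eq_fintype_card, ← Finset.card_univ,
    ← Finset.card_erase_of_mem (Finset.mem_univ (0 : V)), Finset.card_eq_sum_ones,
    ← Finset.filter_ne' , Finset.sum_filter]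
  refine Finset.sum_congr rfl fun a _ => ?_
  split_ifs with ha
  · obtain ⟨i, hi, huniq⟩ := hR a ha
    rw [Finset.sum_eq_single i (fun j _ hj => if_neg fun h => hj (huniq j h)) (by simp),
      if_pos hi]
  · simp

open Classical in
/-- If all members of a vector space partition over `𝔽₂` are even dimensional, their number is
determined modulo 4. -/
theorem exists_card_eq_of_existsUnique_mem (hR : ∀ a : V, a ≠ 0 → ∃! i, a ∈ R i)
    (heven : ∀ i, Even (Module.finrank (ZMod 2) (R i))) :
    ∃ u, 12 * u + 3 * ({i | R i ≠ ⊥} : Finset ι).card = Nat.card V - 1 := by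
  have h (i : ι) : ∃ u, R i ≠ ⊥ → Nat.card (R i) - 1 = 12 * u + 3 := by
    by_cases hi : R i = ⊥
    · exact ⟨0, fun h => (h hi).elim⟩
    · obtain ⟨u, hu⟩ := exists_two_pow_eq_of_even (heven i) (by simpa using hi)
      refine ⟨u, fun _ => ?_⟩
      rw [Module.natCard_eq_pow_finrank (K := ZMod 2), Nat.card_zmod, hu]
      omega
  choose u hu using h
  refine ⟨∑ i with R i ≠ ⊥, u i, ?_⟩
  rw [← sum_card_sub_one_of_existsUnique_mem hR, Finset.sum_congr rfl
    fun i hi => hu i (Finset.mem_filter.1 hi).2, Finset.sum_add_distrib, Finset.mul_sum]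
  simp [mul_comm]

open Classical in
/-- A member `R i ≠ ⊤` of a vector space partition meets every other member trivially, so each
element of a coset of `R i` lies in a different member. -/
theorem card_add_one_le_of_existsUnique_mem (hR : ∀ a : V, a ≠ 0 → ∃! i, a ∈ R i)
    {i : ι} (hi : R i ≠ ⊤) (hi' : R i ≠ ⊥) :
    Nat.card (R i) + 1 ≤ ({i | R i ≠ ⊥} : Finset ι).card := by
  have := Fintype.ofFinite V
  obtain ⟨v, hv⟩ : ∃ v, v ∉ R i := by
    by_contra! h
    exact hi (Submodule.eq_top_iff'.2 h)
  have hne (w : R i) : v + w ≠ 0 := fun h => hv <| by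
    rw [eq_neg_of_add_eq_zero_left h]; exact neg_mem w.2
  choose p hp huniq using fun w : R i => hR (v + w) (hne w)
  have hpi (w : R i) : p w ≠ i := fun h => hv <| by
    have := hp w
    rw [h] at this
    exact ((R i).add_mem_iff_left w.2).1 this
  have hinj : Function.Injective p := by
    intro w w' h
    by_contra hww
    have hsub : (w : V) - w' ≠ 0 := fun h0 => hww (Subtype.ext (sub_eq_zero.1 h0))
    have h1 : (w : V) - w' ∈ R (p w) := by
      have := sub_mem (hp w) (h ▸ hp w')
      rwa [add_sub_add_left_eq_sub] at this
    exact hpi w ((hR _ hsub).unique h1 (sub_mem w.2 w'.2))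
  have hsub : Finset.univ.image p ⊆ ({i | R i ≠ ⊥} : Finset ι).erase i := by
    intro j hj
    obtain ⟨w, -, rfl⟩ := Finset.mem_image.1 hj
    simp only [Finset.mem_erase, Finset.mem_filter, Finset.mem_univ, true_and]
    exact ⟨hpi w, fun h => hne w ((Submodule.mem_bot (ZMod 2)).1 (h ▸ hp w))⟩
  have hle := Finset.card_le_card hsub
  rw [Finset.card_image_of_injective _ hinj, Finset.card_univ, ← Nat.card_eq_fintype_card,
    Finset.card_erase_of_mem (by simpa using hi')] at hle
  have hpos : 0 < ({i | R i ≠ ⊥} : Finset ι).card := Finset.card_pos.2 ⟨i, by simpa using hi'⟩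
  omega

open Classical in
/-- A nontrivial vector space partition of a `2m`-dimensional space over `𝔽₂` has at least
`2 ^ m + 1` members. -/
theorem two_pow_add_one_le_card_of_existsUnique_mem (hR : ∀ a : V, a ≠ 0 → ∃! i, a ∈ R i)
    (htop : ∀ i, R i ≠ ⊤) {m : ℕ} (hm : m ≠ 0) (hV : Nat.card V = 2 ^ (2 * m)) :
    2 ^ m + 1 ≤ ({i | R i ≠ ⊥} : Finset ι).card := by
  by_cases hlarge : ∃ i, R i ≠ ⊥ ∧ 2 ^ m ≤ Nat.card (R i)
  · obtain ⟨i, hi, hle⟩ := hlarge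
    have := card_add_one_le_of_existsUnique_mem hR (htop i) hi
    omega
  · push Not at hlarge
    have hsum : Nat.card V - 1 ≤ ({i | R i ≠ ⊥} : Finset ι).card * (2 ^ m - 1) := by
      rw [← sum_card_sub_one_of_existsUnique_mem hR, ← smul_eq_mul]
      refine Finset.sum_le_card_nsmul _ _ _ fun i hi => ?_
      have := hlarge i (Finset.mem_filter.1 hi).2
      omega
    have hm2 : 2 ≤ 2 ^ m := Nat.le_self_pow hm 2
    have hfactor : (2 ^ m + 1) * (2 ^ m - 1) = Nat.card V - 1 := by
      rw [hV, mul_comm 2 m, pow_mul, ← Nat.sq_sub_sq, one_pow]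
    exact Nat.le_of_mul_le_mul_right (hfactor.trans_le hsum) (by omega)

end Partition

/-- A nonzero linear functional over `𝔽₂`, shifted by a constant, is balanced. -/
theorem two_mul_wt_linear_add_const {V : Type*} [AddCommGroup V] [Module (ZMod 2) V] [Fintype V]
    {f : V →ₗ[ZMod 2] ZMod 2} (hf : f ≠ 0) (c : ZMod 2) :
    2 * wt (fun x => f x + c) = Fintype.card V := by
  obtain ⟨y, hy⟩ : ∃ y, f y = 1 := by
    by_contra! h
    exact hf (LinearMap.ext fun y => (Fin.eq_one_of_ne_zero (f y)).mt (h y) |> not_not.1)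
  have hswap : wt (fun x => f x + c) = (Finset.univ.filter fun x => ¬ f x + c = 1).card := by
    refine Finset.card_equiv (Equiv.addRight y) fun x => ?_
    simp only [Finset.mem_filter, Finset.mem_univ, true_and, Equiv.coe_addRight, map_add, hy]
    generalize f x = u
    revert u c
    decide
  rw [two_mul]
  nth_rewrite 2 [hswap]
  exact Finset.card_filter_add_card_filter_not _

section Quadratic

variable {n : ℕ} {Q : (Fin n → ZMod 2) → (Fin n → ZMod 2)}

theorem derivative_three_eq_zero (hQ : ∀ lam : Fin n → ZMod 2, lam ≠ 0 → degLE 2 (comp lam Q))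
    (x a b c : Fin n → ZMod 2) :
    Q (x + a + b + c) + Q (x + a + b) + (Q (x + a + c) + Q (x + a)) +
      (Q (x + b + c) + Q (x + b) + (Q (x + c) + Q x)) = 0 := by
  funext i
  have h := congrFun (hQ (Pi.single i 1) (by simp) [a, b, c] rfl) x
  simpa [Dop, comp, Pi.single_apply] using h

/-- The polar form `Q (x + y) + Q x + Q y + Q 0` of a quadratic vectorial function. -/
def polarForm (Q : (Fin n → ZMod 2) → (Fin n → ZMod 2))
    (hQ : ∀ lam : Fin n → ZMod 2, lam ≠ 0 → degLE 2 (comp lam Q)) :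
    (Fin n → ZMod 2) →ₗ[ZMod 2] (Fin n → ZMod 2) →ₗ[ZMod 2] (Fin n → ZMod 2) :=
  have hadd (z x y : Fin n → ZMod 2) : Q (x + y + z) + Q (x + y) + Q z + Q 0 =
      Q (x + z) + Q x + Q z + Q 0 + (Q (y + z) + Q y + Q z + Q 0) := by
    have h := derivative_three_eq_zero hQ 0 x y z
    simp only [zero_add] at h
    funext i
    have hi := congrFun h i
    simp only [Pi.add_apply, Pi.zero_apply] at hi ⊢
    grind
  have hadd' (z x y : Fin n → ZMod 2) : Q (z + (x + y)) + Q z + Q (x + y) + Q 0 =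
      Q (z + x) + Q z + Q x + Q 0 + (Q (z + y) + Q z + Q y + Q 0) := by
    simpa only [add_comm z, add_right_comm _ (Q z)] using hadd z x y
  LinearMap.mk₂ (ZMod 2) (fun x y => Q (x + y) + Q x + Q y + Q 0)
    (fun x y z => hadd z x y)
    (fun c x y => ZMod.map_smul
      (AddMonoidHom.mk' (fun x => Q (x + y) + Q x + Q y + Q 0) (hadd y)) c x)
    hadd'
    (fun c x y => ZMod.map_smul
      (AddMonoidHom.mk' (fun y => Q (x + y) + Q x + Q y + Q 0) (hadd' x)) c y)

variable {hQ : ∀ lam : Fin n → ZMod 2, lam ≠ 0 → degLE 2 (comp lam Q)}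

theorem polarForm_apply (x y : Fin n → ZMod 2) :
    polarForm Q hQ x y = Q (x + y) + Q x + Q y + Q 0 := rfl

theorem polarForm_self (x : Fin n → ZMod 2) : polarForm Q hQ x x = 0 := by
  rw [polarForm_apply, ZModModule.add_self, add_assoc (Q 0), ZModModule.add_self, add_zero,
    ZModModule.add_self]

theorem add_derivative_eq_polarForm_add (a x : Fin n → ZMod 2) :
    Q (x + a) + Q x = polarForm Q hQ a x + (Q a + Q 0) := by
  rw [polarForm_apply, add_comm a x]
  funext i
  simp only [Pi.add_apply]
  grind

variable (hQ) in
/-- The polar form of the component `comp lam Q`. -/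
def componentForm (lam : Fin n → ZMod 2) : LinearMap.BilinForm (ZMod 2) (Fin n → ZMod 2) :=
  (polarForm Q hQ).compr₂ (dotProductEquiv (ZMod 2) (Fin n) lam)

theorem componentForm_apply (lam x y : Fin n → ZMod 2) :
    componentForm hQ lam x y = lam ⬝ᵥ polarForm Q hQ x y := rfl

theorem isAlt_componentForm (lam : Fin n → ZMod 2) : (componentForm hQ lam).IsAlt := fun x => by
  rw [componentForm_apply, polarForm_self, dotProduct_zero]

theorem Dop_comp_eq (lam a x : Fin n → ZMod 2) :
    Dop a (comp lam Q) x = componentForm hQ lam a x + lam ⬝ᵥ (Q a + Q 0) := by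
  rw [componentForm_apply, ← dotProduct_add, ← add_derivative_eq_polarForm_add, dotProduct_add]
  rfl

theorem isBent_comp_iff (hn : n ≠ 0) (lam : Fin n → ZMod 2) :
    IsBent (comp lam Q) ↔ LinearMap.ker (componentForm hQ lam) = ⊥ := by
  have hpow : 2 * 2 ^ (n - 1) = 2 ^ n := by rw [← pow_succ', Nat.sub_add_cancel (by omega)]
  rw [LinearMap.ker_eq_bot']
  refine ⟨fun h a ha => ?_, fun h a ha => ?_⟩
  · by_contra ha0
    have hwt := h a ha0
    rw [funext (Dop_comp_eq (hQ := hQ) lam a)] at hwt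
    have hpos : 0 < 2 ^ (n - 1) := by positivity
    simp only [ha, LinearMap.zero_apply, zero_add, wt, Finset.filter_const] at hwt
    split_ifs at hwt
    · simp at hwt
      omega
    · exact hpos.ne hwt
  · have := two_mul_wt_linear_add_const (mt (h a) ha) (lam ⬝ᵥ (Q a + Q 0))
    rw [funext (Dop_comp_eq (hQ := hQ) lam a)]
    simp only [Fintype.card_fun, ZMod.card, Fintype.card_fin] at this
    omega

theorem ker_componentForm_ne_top {lam : Fin n → ZMod 2} (h : ¬ degLE 1 (comp lam Q)) :
    LinearMap.ker (componentForm hQ lam) ≠ ⊤ := by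
  refine fun htop => h fun l hl => ?_
  obtain ⟨a, b, rfl⟩ := List.length_eq_two.1 hl
  have hb : componentForm hQ lam b = 0 := LinearMap.mem_ker.1 (htop ▸ Submodule.mem_top)
  funext x
  change Dop b (comp lam Q) (x + a) + Dop b (comp lam Q) x = 0
  simp only [Dop_comp_eq (hQ := hQ), hb, LinearMap.zero_apply]
  exact CharTwo.add_self_eq_zero _

open Module in
theorem finrank_ker_polarForm (hapn : IsAPN Q) {a : Fin n → ZMod 2} (ha : a ≠ 0) :
    finrank (ZMod 2) (LinearMap.ker (polarForm Q hQ a)) = 1 := by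
  refine finrank_eq_one_iff'.2 ⟨⟨a, polarForm_self a⟩, mt (congrArg Subtype.val) ha,
    fun ⟨x, hx⟩ => ?_⟩
  by_contra! hne
  have hx0 : x ≠ 0 := fun h => hne 0 (Subtype.ext (by simp [h]))
  have hxa : x ≠ a := fun h => hne 1 (Subtype.ext (by simp [h]))
  have hsub : ({0, a, x} : Finset (Fin n → ZMod 2)) ⊆
      Finset.univ.filter fun x => Q (x + a) + Q x = Q a + Q 0 := by
    have hmem (y) (hy : polarForm Q hQ a y = 0) : Q (y + a) + Q y = Q a + Q 0 := by
      rw [add_derivative_eq_polarForm_add (hQ := hQ), hy, zero_add]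
    simp [Finset.insert_subset_iff, hmem a (polarForm_self a), hmem x hx]
  have hle := (Finset.card_le_card hsub).trans (hapn a ha _)
  rw [Finset.card_eq_three.2 ⟨0, a, x, ha.symm, hx0.symm, hxa.symm, rfl⟩] at hle
  omega

open Module in
/-- For an APN quadratic function, each nonzero vector lies in the radical of exactly one nonzero
component. -/
theorem existsUnique_mem_ker_componentForm (hapn : IsAPN Q) {a : Fin n → ZMod 2} (ha : a ≠ 0) :
    ∃! lam : {lam : Fin n → ZMod 2 // lam ≠ 0}, a ∈ LinearMap.ker (componentForm hQ lam) := by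
  let T := (polarForm Q hQ a).dualMap ∘ₗ (dotProductEquiv (ZMod 2) (Fin n)).toLinearMap
  have hT (lam : Fin n → ZMod 2) :
      a ∈ LinearMap.ker (componentForm hQ lam) ↔ lam ∈ LinearMap.ker T := Iff.rfl
  have hrange : finrank (ZMod 2) (LinearMap.range T) =
      finrank (ZMod 2) (LinearMap.range (polarForm Q hQ a)) := by
    rw [LinearMap.range_comp, LinearEquiv.range, Submodule.map_top,
      LinearMap.finrank_range_dualMap_eq_finrank_range]
  have hker : finrank (ZMod 2) (LinearMap.ker T) = 1 := by
    have h1 := LinearMap.finrank_range_add_finrank_ker T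
    have h2 := LinearMap.finrank_range_add_finrank_ker (polarForm Q hQ a)
    rw [finrank_ker_polarForm hapn ha] at h2
    omega
  obtain ⟨⟨lam, hlam⟩, hlam0, hspan⟩ := finrank_eq_one_iff'.1 hker
  refine ⟨⟨lam, fun h => hlam0 (Subtype.ext h)⟩, (hT _).2 hlam, fun ⟨mu, hmu0⟩ hmu => ?_⟩
  obtain ⟨c, hc⟩ := hspan ⟨mu, (hT _).1 hmu⟩
  have hc' : c • lam = mu := congrArg Subtype.val hc
  have hc1 : c = 1 :=
    (by decide : ∀ c : ZMod 2, c ≠ 0 → c = 1) c (fun h => hmu0 (by rw [← hc', h, zero_smul]))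
  exact Subtype.ext (by simpa [hc1] using hc'.symm)

end Quadratic

theorem stmt_16 (n : ℕ) (hne : Even n) (hn : 4 ≤ n)
    (Q : (Fin n → ZMod 2) → (Fin n → ZMod 2))
    (hquad : ∀ lam : Fin n → ZMod 2, lam ≠ 0 →
      degLE 2 (comp lam Q) ∧ ¬ degLE 1 (comp lam Q))
    (hapn : IsAPN Q) :
    ∀ B : ℕ, B = {lam : Fin n → ZMod 2 | lam ≠ 0 ∧ IsBent (comp lam Q)}.ncard →
      (∃ t : ℕ, B = 2 * (2 ^ n - 1) / 3 + 4 * t) ∧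
      2 * (2 ^ n - 1) / 3 ≤ B ∧ B ≤ 2 ^ n - 2 ^ (n / 2) - 2 := by
  classical
  rintro B rfl
  have hQ lam hlam := (hquad lam hlam).1
  let R (lam : {lam : Fin n → ZMod 2 // lam ≠ 0}) := LinearMap.ker (componentForm hQ lam.1)
  have hR (a : Fin n → ZMod 2) (ha : a ≠ 0) : ∃! lam, a ∈ R lam :=
    existsUnique_mem_ker_componentForm hapn ha
  have heven lam : Even (Module.finrank (ZMod 2) (R lam)) := by
    have h := (isAlt_componentForm (hQ := hQ) lam.1).even_finrank_add_finrank_ker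
    rw [Module.finrank_fin_fun] at h
    exact (Nat.even_add.1 h).1 hne
  have hcard : Nat.card (Fin n → ZMod 2) = 2 ^ n := by simp
  obtain ⟨u, hu⟩ := exists_card_eq_of_existsUnique_mem hR heven
  obtain ⟨m, rfl⟩ := hne
  have hlow := two_pow_add_one_le_card_of_existsUnique_mem hR
    (fun lam => ker_componentForm_ne_top (hquad lam.1 lam.2).2) (m := m) (by omega)
    (by rw [hcard, two_mul])
  have hbent : {lam : Fin (m + m) → ZMod 2 | lam ≠ 0 ∧ IsBent (comp lam Q)}.ncard =
      ({lam | R lam = ⊥} : Finset {lam : Fin (m + m) → ZMod 2 // lam ≠ 0}).card := by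
    rw [← Finset.card_map (Function.Embedding.subtype _), ← Set.ncard_coe_finset]
    congr 1
    ext lam
    simp [and_comm, R, isBent_comp_iff (hQ := hQ) (show m + m ≠ 0 by omega)]
  have htotal : Fintype.card {lam : Fin (m + m) → ZMod 2 // lam ≠ 0} = 2 ^ (m + m) - 1 := by
    simp [Fintype.card_subtype_compl]
  have hsplit : ({lam | R lam = ⊥} : Finset _).card + ({lam | R lam ≠ ⊥} : Finset _).card =
      2 ^ (m + m) - 1 := by
    rw [← htotal, ← Finset.card_univ]
    convert Finset.card_filter_add_card_filter_not (s := Finset.univ) (fun lam => R lam = ⊥)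
  rw [hcard] at hu
  rw [hbent, show (m + m) / 2 = m by omega]
  exact ⟨⟨u, by omega⟩, by omega, by omega⟩
end
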